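/- Let (X,d) be a compact metric space, T : X → X a continuous map, and φ ∈ C(X,ℝ). Then the maximum ergodic average satisfies α(φ) = inf_{n∈ℕ, n≥1} sup_{x∈X} S_nφ(x)/n. -/

import Mathlib

open MeasureTheory Filter Topology

/-- The Birkhoff sum `S_n φ(x) = ∑_{i=0}^{n-1} φ(T^i x)`. -/
noncomputable def birkhoffAvgSum {X : Type*} [TopologicalSpace X] (T : X → X) (φ : C(X, ℝ)) (n : ℕ) (x : X) : ℝ :=
  ∑ i ∈ Finset.range n, φ (T^[i] x)

/-- The maximum ergodic average `α(φ) = sup_{μ ∈ M_T(X)} ∫ φ dμ`. -/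
noncomputable def maxErgAvg {X : Type*} [MetricSpace X] [MeasurableSpace X] [BorelSpace X]
    (T : X → X) (φ : C(X, ℝ)) : ℝ :=
  sSup {r : ℝ | ∃ μ : Measure X, IsProbabilityMeasure μ ∧ μ.map T = μ ∧ r = ∫ x, φ x ∂μ}

/-- The empirical measure along an orbit segment of length `n + 1`. -/
noncomputable def empMeas {X : Type*} [MeasurableSpace X] (T : X → X) (n : ℕ) (x : X) : Measure X :=
  ((n : ENNReal) + 1)⁻¹ • ∑ i ∈ Finset.range (n + 1), Measure.dirac (T^[i] x)

lemma empMeas_prob {X : Type*} [MeasurableSpace X] (T : X → X) (n : ℕ) (x : X) :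
    IsProbabilityMeasure (empMeas T n x) := by
  constructor
  simp only [empMeas, Measure.smul_apply, Measure.finsetSum_apply, measure_univ,
    Finset.sum_const, Finset.card_range, smul_eq_mul, nsmul_eq_mul, mul_one]
  push_cast
  exact ENNReal.inv_mul_cancel (by simp) (by finiteness)

lemma integral_empMeas {X : Type*} [MetricSpace X] [CompactSpace X]
    [MeasurableSpace X] [BorelSpace X] (T : X → X) (n : ℕ) (x : X) (f : C(X, ℝ)) :
    ∫ y, f y ∂(empMeas T n x) = birkhoffAvgSum T f (n + 1) x / ((n : ℝ) + 1) := by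
  rw [empMeas, integral_smul_measure, integral_finsetSum_measure]
  · simp only [integral_dirac, birkhoffAvgSum]
    rw [ENNReal.toReal_inv, ENNReal.toReal_add (by simp) (by simp)]
    simp [div_eq_inv_mul]
  · intro i _
    exact f.continuous.integrable_of_hasCompactSupport (HasCompactSupport.of_compactSpace _)

lemma birkhoffAvgSum_bdd {X : Type*} [MetricSpace X] [CompactSpace X] (T : X → X)
    (hT : Continuous T) (φ : C(X, ℝ)) (n : ℕ) :
    Continuous (fun x => birkhoffAvgSum T φ n x / n) := by
  unfold birkhoffAvgSum
  have := fun i => hT.iterate i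
  fun_prop

lemma inv_le {X : Type*} [MetricSpace X] [CompactSpace X]
    [MeasurableSpace X] [BorelSpace X] (T : X → X) (hT : Continuous T) (φ : C(X, ℝ))
    (μ : Measure X) [IsProbabilityMeasure μ] (hμ : μ.map T = μ) (n : ℕ+) :
    ∫ x, φ x ∂μ ≤ ⨆ x : X, birkhoffAvgSum T φ n x / n := by
  have hint : ∀ g : X → ℝ, Continuous g → Integrable g μ := fun g hg =>
    hg.integrable_of_hasCompactSupport (HasCompactSupport.of_compactSpace _)
  have hmp : MeasurePreserving T μ μ := ⟨hT.measurable, hμ⟩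
  have hc := birkhoffAvgSum_bdd T hT φ n
  have h1 : ∫ x, birkhoffAvgSum T φ n x / (n : ℕ) ∂μ = ∫ x, φ x ∂μ := by
    rw [integral_div]
    unfold birkhoffAvgSum
    rw [integral_finsetSum _ (fun i _ => hint (fun a => φ (T^[i] a)) (φ.continuous.comp (hT.iterate i)))]
    have : ∀ i, ∫ x, φ (T^[i] x) ∂μ = ∫ x, φ x ∂μ := by
      intro i
      have h := (hmp.iterate i)
      conv_rhs => rw [← h.map_eq]
      rw [integral_map h.measurable.aemeasurable φ.continuous.aestronglyMeasurable]
    simp only [this, Finset.sum_const, Finset.card_range, nsmul_eq_mul]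
    have : ((n : ℕ) : ℝ) ≠ 0 := by exact_mod_cast n.ne_zero
    field_simp
  rw [← h1]
  calc _ ≤ ∫ _, (⨆ x : X, birkhoffAvgSum T φ n x / (n : ℕ)) ∂μ := by
        apply integral_mono (hint _ hc) (integrable_const _)
        intro x
        exact le_ciSup (isCompact_range hc).bddAbove x
    _ = _ := by simp

lemma exists_inv {X : Type*} [MetricSpace X] [CompactSpace X] [Nonempty X]
    [MeasurableSpace X] [BorelSpace X] (T : X → X) (hT : Continuous T) (φ : C(X, ℝ)) (c : ℝ)
    (hc : ∀ n : ℕ, ∃ x, c ≤ birkhoffAvgSum T φ (n + 1) x / ((n : ℝ) + 1)) :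
    ∃ μ : Measure X, IsProbabilityMeasure μ ∧ μ.map T = μ ∧ c ≤ ∫ x, φ x ∂μ := by
  choose x hx using hc
  let ν : ℕ → ProbabilityMeasure X := fun n => ⟨empMeas T n (x n), empMeas_prob T n (x n)⟩
  let F : Ultrafilter ℕ := hyperfilter ℕ
  have hF : (F : Filter ℕ) ≤ atTop := Nat.hyperfilter_le_atTop
  obtain ⟨μ, -, hμ⟩ := isCompact_univ.ultrafilter_le_nhds (F.map ν) (by simp)
  have hlim : Tendsto ν F (𝓝 μ) := hμ
  rw [ProbabilityMeasure.tendsto_iff_forall_integral_tendsto] at hlim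
  have hl : ∀ f : C(X, ℝ), Tendsto (fun n : ℕ => birkhoffAvgSum T f (n + 1) (x n) / ((n : ℝ) + 1))
      F (𝓝 (∫ y, f y ∂(μ : Measure X))) := by
    intro f
    have := hlim (BoundedContinuousFunction.mkOfCompact f)
    refine this.congr fun n => ?_
    exact integral_empMeas T n (x n) f
  refine ⟨μ, inferInstance, ?_, ?_⟩
  · have : IsProbabilityMeasure ((μ : Measure X).map T) :=
      Measure.isProbabilityMeasure_map hT.measurable.aemeasurable
    apply ext_of_forall_integral_eq_of_IsFiniteMeasure
    intro f
    rw [integral_map hT.measurable.aemeasurable f.continuous.aestronglyMeasurable]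
    have h1 := (hl (f.toContinuousMap.comp ⟨T, hT⟩)).sub (hl f.toContinuousMap)
    have h2 : Tendsto (fun n : ℕ =>
        birkhoffAvgSum T (f.toContinuousMap.comp ⟨T, hT⟩) (n + 1) (x n) / ((n : ℝ) + 1)
        - birkhoffAvgSum T f.toContinuousMap (n + 1) (x n) / ((n : ℝ) + 1)) F (𝓝 0) := by
      have h3 : Tendsto (fun n : ℕ => (2 * ‖f‖) * (1 / ((n : ℝ) + 1))) F (𝓝 0) := by
        simpa using ((tendsto_one_div_add_atTop_nhds_zero_nat (𝕜 := ℝ)).mono_left hF).const_mul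
          (2 * ‖f‖)
      refine squeeze_zero_norm (fun n => ?_) h3
      have h4 : birkhoffAvgSum T (f.toContinuousMap.comp ⟨T, hT⟩) (n + 1) (x n)
          - birkhoffAvgSum T f.toContinuousMap (n + 1) (x n) = f (T^[n + 1] (x n)) - f (x n) := by
        have := Finset.sum_range_sub (fun i => f (T^[i] (x n))) (n + 1)
        simp only [Function.iterate_zero, id] at this
        rw [← this]
        simp only [birkhoffAvgSum, ← Finset.sum_sub_distrib]
        refine Finset.sum_congr rfl fun i _ => ?_
        rw [Function.iterate_succ_apply']
        rfl
      rw [← sub_div, h4, norm_div, div_eq_mul_one_div]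
      have h5 : ‖(n : ℝ) + 1‖ = (n : ℝ) + 1 := Real.norm_of_nonneg (by positivity)
      rw [h5]
      gcongr
      calc _ ≤ ‖f (T^[n + 1] (x n))‖ + ‖f (x n)‖ := norm_sub_le _ _
        _ ≤ ‖f‖ + ‖f‖ := add_le_add (f.norm_coe_le_norm _) (f.norm_coe_le_norm _)
        _ = _ := by ring
    exact sub_eq_zero.mp (tendsto_nhds_unique h1 h2)
  · exact ge_of_tendsto' (hl φ) hx

/-- `α(φ) = inf_{n≥1} sup_{x∈X} S_nφ(x)/n`. -/
theorem maxErgAvg_eq_inf_sup {X : Type*} [MetricSpace X] [CompactSpace X] [Nonempty X]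
    [MeasurableSpace X] [BorelSpace X] (T : X → X) (hT : Continuous T) (φ : C(X, ℝ)) :
    maxErgAvg T φ =
      ⨅ n : ℕ+, ⨆ x : X, birkhoffAvgSum T φ n x / n := by
  set c := ⨅ n : ℕ+, ⨆ x : X, birkhoffAvgSum T φ n x / n with hcdef
  have hbdd : BddBelow (Set.range fun n : ℕ+ => ⨆ x : X, birkhoffAvgSum T φ n x / n) := by
    obtain ⟨μ, hμ, hinv, -⟩ := exists_inv T hT 0 0 (fun n => ⟨Classical.arbitrary X, by
      simp [birkhoffAvgSum]⟩)
    refine ⟨∫ x, φ x ∂μ, ?_⟩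
    rintro _ ⟨n, rfl⟩
    exact inv_le T hT φ μ hinv n
  obtain ⟨μ, hμ, hinv, hle⟩ := exists_inv T hT φ c (by
    intro n
    have hcont := birkhoffAvgSum_bdd T hT φ (n + 1)
    obtain ⟨x, -, hx⟩ := isCompact_univ.exists_isMaxOn Set.univ_nonempty hcont.continuousOn
    refine ⟨x, (ciInf_le hbdd n.succPNat).trans (ciSup_le fun y => ?_)⟩
    simpa using hx (Set.mem_univ y))
  have hub : ∀ r ∈ {r : ℝ | ∃ μ : Measure X, IsProbabilityMeasure μ ∧ μ.map T = μ ∧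
      r = ∫ x, φ x ∂μ}, r ≤ c := by
    rintro r ⟨ν, hν, hνi, rfl⟩
    exact le_ciInf fun n => inv_le T hT φ ν hνi n
  exact le_antisymm (csSup_le ⟨_, μ, hμ, hinv, rfl⟩ hub)
    (hle.trans (le_csSup ⟨c, hub⟩ ⟨μ, hμ, hinv, rfl⟩))
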